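/- Consider the attitude kinematics and observer on SO(3): R, R̄ : ℝ → ℝ³ˣ³ are differentiable with R(t), R̄(t) ∈ SO(3) for all t ≥ 0, Ω : ℝ → ℝ³, γ ∈ ℝ³ is a constant gyro bias, γ̄ : ℝ → ℝ³ is differentiable, s₁,…,sₙ : ℝ → ℝ³ are differentiable with ‖sᵢ(t)‖ = 1, wᵢ > 0, G(t) = Σᵢ wᵢ sᵢ(t)sᵢ(t)ᵀ, e_R(t) = (R(t)ᵀG(t)R̄(t) − R̄(t)ᵀG(t)R(t))^∨, and the equations R′(t) = R(t)·(Ω(t))^, R̄′(t) = R̄(t)·(Ω(t) + γ − γ̄(t) − k_R e_R(t))^, γ̄′(t) = k_γ e_R(t) hold for positive gains k_R, k_γ. Assume there are constants 0 < c₁ ≤ c₂ and d > 0 such that for all t ≥ 0 the eigenvalues λ₁(t) ≤ λ₂(t) ≤ λ₃(t) of G(t) satisfy λ₁(t)+λ₂(t) ≥ c₁ and λ₂(t)+λ₃(t) ≤ c₂, and ‖G′(t)‖ ≤ d. Set E_R(t) = R(t) − R̄(t), e_γ(t) = γ − γ̄(t), and V₀(t) = ½⟨G(t)E_R(t), E_R(t)⟩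 + (1/(2k_γ))‖e_γ(t)‖². Fix a ∈ (0, ½) and assume k_R > 2d/c₁². If V₀(0) < 2a·c₁, then V₀(t) < 2a·c₁ for all t ≥ 0 and, moreover, V₀ is nonincreasing on [0, ∞); i.e., the set D = {V₀ < 2a·c₁} is positively invariant. -/

import Mathlib

open Matrix Polynomial

noncomputable section

/-- The hat map sending `x ∈ ℝ³` to the skew-symmetric matrix `x̂` with `x̂ y = x × y`. -/
def hat (x : Fin 3 → ℝ) : Matrix (Fin 3) (Fin 3) ℝ :=
  !![0, -x 2, x 1; x 2, 0, -x 0; -x 1, x 0, 0]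

/-- The vee map, inverse of the hat map on skew-symmetric `3 × 3` matrices. -/
def vee (A : Matrix (Fin 3) (Fin 3) ℝ) : Fin 3 → ℝ :=
  ![A 2 1, A 0 2, A 1 0]

/-- `SO3 R` iff `R` is a rotation matrix: `RᵀR = I₃` and `det R = 1`. -/
def SO3 (R : Matrix (Fin 3) (Fin 3) ℝ) : Prop :=
  Rᵀ * R = 1 ∧ R.det = 1

/-- Frobenius inner product `⟨A,B⟩ = tr(AᵀB)`. -/
def finner (A B : Matrix (Fin 3) (Fin 3) ℝ) : ℝ := (Aᵀ * B).trace

/-- Frobenius norm `‖A‖ = √⟨A,A⟩`. -/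
def fnorm (A : Matrix (Fin 3) (Fin 3) ℝ) : ℝ := Real.sqrt (finner A A)

/-- Euclidean norm of a vector. -/
def vnorm {k : ℕ} (x : Fin k → ℝ) : ℝ := Real.sqrt (x ⬝ᵥ x)

/-- Third standard basis vector `e₃ = (0,0,1)` of `ℝ³`. -/
def e3 : Fin 3 → ℝ := ![0, 0, 1]

/-- Entrywise derivative of a matrix-valued curve, avoiding a choice of matrix norm. -/
def EntryDerivAt (A : ℝ → Matrix (Fin 3) (Fin 3) ℝ) (A' : Matrix (Fin 3) (Fin 3) ℝ)
    (t : ℝ) : Prop :=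
  ∀ i j, HasDerivAt (fun τ => A τ i j) (A' i j) t

namespace EntryDerivAt

variable {A B : ℝ → Matrix (Fin 3) (Fin 3) ℝ} {A' B' : Matrix (Fin 3) (Fin 3) ℝ} {t : ℝ}

lemma sub (hA : EntryDerivAt A A' t) (hB : EntryDerivAt B B' t) :
    EntryDerivAt (fun τ => A τ - B τ) (A' - B') t :=
  fun i j => (hA i j).sub (hB i j)

lemma transpose (hA : EntryDerivAt A A' t) :
    EntryDerivAt (fun τ => (A τ)ᵀ) A'ᵀ t :=
  fun i j => hA j i

lemma mul (hA : EntryDerivAt A A' t) (hB : EntryDerivAt B B' t) :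
    EntryDerivAt (fun τ => A τ * B τ) (A' * B t + A t * B') t := by
  intro i j
  simp only [Matrix.mul_apply, Matrix.add_apply, ← Finset.sum_add_distrib]
  exact HasDerivAt.fun_sum fun k _ => (hA i k).mul (hB k j)

lemma trace (hA : EntryDerivAt A A' t) :
    HasDerivAt (fun τ => (A τ).trace) A'.trace t := by
  simp only [Matrix.trace, Matrix.diag]
  exact HasDerivAt.fun_sum fun k _ => hA k k

end EntryDerivAt

lemma vnorm_sq {k : ℕ} (x : Fin k → ℝ) : vnorm x ^ 2 = x ⬝ᵥ x := by
  refine Real.sq_sqrt ?_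
  exact Finset.sum_nonneg fun i _ => mul_self_nonneg _

lemma finner_eq_sum (A B : Matrix (Fin 3) (Fin 3) ℝ) :
    finner A B = ∑ p : Fin 3 × Fin 3, A p.1 p.2 * B p.1 p.2 := by
  simp only [finner, Matrix.trace, Matrix.diag, Matrix.mul_apply, Matrix.transpose_apply]
  rw [Finset.sum_comm, Fintype.sum_prod_type]

lemma finner_self_nonneg (A : Matrix (Fin 3) (Fin 3) ℝ) : 0 ≤ finner A A := by
  rw [finner_eq_sum]
  exact Finset.sum_nonneg fun p _ => mul_self_nonneg _

lemma finner_sq_le (A B : Matrix (Fin 3) (Fin 3) ℝ) :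
    finner A B ^ 2 ≤ finner A A * finner B B := by
  simp only [finner_eq_sum, ← sq]
  exact Finset.sum_mul_sq_le_sq_mul_sq _ _ _

lemma fnorm_sq (A : Matrix (Fin 3) (Fin 3) ℝ) : fnorm A ^ 2 = finner A A :=
  Real.sq_sqrt (finner_self_nonneg A)

lemma trace_mul_hat (A : Matrix (Fin 3) (Fin 3) ℝ) (x : Fin 3 → ℝ) :
    (A * hat x).trace = -(vee (A - Aᵀ) ⬝ᵥ x) := by
  simp [Matrix.trace, Matrix.mul_apply, Fin.sum_univ_three, hat, vee, dotProduct]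
  ring

lemma finner_sub_transpose_self (A : Matrix (Fin 3) (Fin 3) ℝ) :
    finner (A - Aᵀ) (A - Aᵀ) = 2 * (vee (A - Aᵀ) ⬝ᵥ vee (A - Aᵀ)) := by
  simp [finner, Matrix.trace, Matrix.mul_apply, Fin.sum_univ_three, vee, dotProduct]
  ring

lemma adjugate_eq_sq_sub (A : Matrix (Fin 3) (Fin 3) ℝ) :
    A.adjugate = A * A - A.trace • A + A.adjugate.trace • 1 := by
  rw [Matrix.adjugate_fin_three]
  ext i j
  fin_cases i <;> fin_cases j <;>
    simp [Matrix.mul_apply, Matrix.trace, Fin.sum_univ_three] <;> ring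

namespace SO3

variable {Q R S : Matrix (Fin 3) (Fin 3) ℝ}

lemma mul_transpose_self (hQ : SO3 Q) : Q * Qᵀ = 1 := mul_eq_one_comm.mp hQ.1

lemma mul_transpose (hR : SO3 R) (hS : SO3 S) : SO3 (R * Sᵀ) := by
  refine ⟨?_, by rw [det_mul, det_transpose, hR.2, hS.2, one_mul]⟩
  rw [Matrix.transpose_mul, Matrix.transpose_transpose, Matrix.mul_assoc,
    ← Matrix.mul_assoc Rᵀ, hR.1, Matrix.one_mul, hS.mul_transpose_self]

lemma mul_self_eq (hQ : SO3 Q) : Q * Q = Q.trace • Q - Q.trace • 1 + Qᵀ := by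
  have hadj : Q.adjugate = Qᵀ := by
    have h := Q.mul_adjugate
    rw [hQ.2, one_smul] at h
    calc Q.adjugate = Qᵀ * (Q * Q.adjugate) := by rw [← Matrix.mul_assoc, hQ.1, Matrix.one_mul]
      _ = Qᵀ := by rw [h, Matrix.mul_one]
  have h := adjugate_eq_sq_sub Q
  rw [hadj, trace_transpose] at h
  rw [h]
  abel

lemma trace_mul_self (hQ : SO3 Q) : (Q * Q).trace = Q.trace ^ 2 - 2 * Q.trace := by
  rw [hQ.mul_self_eq]
  simp
  ring

lemma trace_le_three (hQ : SO3 Q) : Q.trace ≤ 3 := by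
  have h := finner_self_nonneg (Q - 1)
  have e : finner (Q - 1) (Q - 1) = 6 - 2 * Q.trace := by
    simp only [finner, Matrix.transpose_sub, Matrix.transpose_one, sub_mul, mul_sub, hQ.1,
      Matrix.mul_one, Matrix.one_mul, Matrix.trace_sub, Matrix.trace_one, Matrix.trace_transpose]
    norm_num
    ring
  linarith

lemma finner_sub_transpose (hQ : SO3 Q) :
    finner (Q - Qᵀ) (Q - Qᵀ) = 2 * (3 - Q.trace) * (1 + Q.trace) := by
  have h2 : (Qᵀ * Qᵀ).trace = (Q * Q).trace := by
    rw [← Matrix.transpose_mul, Matrix.trace_transpose]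
  simp only [finner, Matrix.transpose_sub, Matrix.transpose_transpose, sub_mul, mul_sub, hQ.1,
    hQ.mul_transpose_self, Matrix.trace_sub, Matrix.trace_one, h2, hQ.trace_mul_self]
  norm_num
  ring

lemma finner_symm_part (hQ : SO3 Q) :
    finner ((2 : ℝ) • 1 - Q - Qᵀ) ((2 : ℝ) • 1 - Q - Qᵀ) = 2 * (3 - Q.trace) ^ 2 := by
  have h2 : (Qᵀ * Qᵀ).trace = (Q * Q).trace := by
    rw [← Matrix.transpose_mul, Matrix.trace_transpose]
  simp only [finner, Matrix.transpose_sub, Matrix.transpose_smul, Matrix.transpose_one,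
    Matrix.transpose_transpose, sub_mul, mul_sub, hQ.1, Matrix.smul_mul, Matrix.mul_smul,
    Matrix.one_mul, Matrix.mul_one, Matrix.trace_smul, smul_eq_mul, Matrix.trace_transpose,
    hQ.mul_transpose_self, Matrix.trace_sub, Matrix.trace_one, h2, hQ.trace_mul_self]
  norm_num
  ring

/-- In axis-angle form, `Q + Qᵀ - (tr Q - 1) = (3 - tr Q) u uᵀ`; this is the resulting
projection-like identity. -/
lemma axis_mul_self (hQ : SO3 Q) :
    (Q + Qᵀ - (Q.trace - 1) • 1) * (Q + Qᵀ - (Q.trace - 1) • 1) =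
      (3 - Q.trace) • (Q + Qᵀ - (Q.trace - 1) • 1) := by
  have h := hQ.mul_self_eq
  have h' : Qᵀ * Qᵀ = Q.trace • Qᵀ - Q.trace • 1 + Q := by
    have := congrArg Matrix.transpose h
    simpa using this
  simp only [sub_mul, mul_sub, add_mul, mul_add, h, h', hQ.1, hQ.mul_transpose_self,
    Matrix.smul_mul, Matrix.mul_smul, Matrix.one_mul, Matrix.mul_one]
  module

end SO3

lemma transpose_mul_hat_trace_eq_zero {A : Matrix (Fin 3) (Fin 3) ℝ} (hA : Aᵀ = A)
    (x : Fin 3 → ℝ) : (A * hat x).trace = 0 := by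
  rw [trace_mul_hat, hA]
  simp [vee]

lemma trace_error_mul_deriv {G R S : Matrix (Fin 3) (Fin 3) ℝ} (hG : Gᵀ = G)
    (x y : Fin 3 → ℝ) :
    ((R - S)ᵀ * G * (R * hat x - S * hat (x + y))).trace =
      vee (Rᵀ * G * S - Sᵀ * G * R) ⬝ᵥ y := by
  have hB : (Rᵀ * G * S)ᵀ = Sᵀ * G * R := by
    simp [Matrix.transpose_mul, hG, Matrix.mul_assoc]
  have hRR := transpose_mul_hat_trace_eq_zero (A := Rᵀ * G * R)
    (by simp [Matrix.transpose_mul, hG, Matrix.mul_assoc]) x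
  have hSS := transpose_mul_hat_trace_eq_zero (A := Sᵀ * G * S)
    (by simp [Matrix.transpose_mul, hG, Matrix.mul_assoc]) (x + y)
  have hRS := trace_mul_hat (Rᵀ * G * S) (x + y)
  have hSR := trace_mul_hat (Sᵀ * G * R) x
  rw [hB] at hRS
  rw [← hB, Matrix.transpose_transpose, hB] at hSR
  have hneg : vee (Sᵀ * G * R - Rᵀ * G * S) = -vee (Rᵀ * G * S - Sᵀ * G * R) := by
    ext i; fin_cases i <;> simp [vee]
  rw [hneg, neg_dotProduct, neg_neg] at hSR
  have e : (R - S)ᵀ * G * (R * hat x - S * hat (x + y)) =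
      Rᵀ * G * R * hat x - Rᵀ * G * S * hat (x + y) - Sᵀ * G * R * hat x +
        Sᵀ * G * S * hat (x + y) := by
    rw [Matrix.transpose_sub]
    noncomm_ring
  rw [e, Matrix.trace_add, Matrix.trace_sub, Matrix.trace_sub, hRR, hSS, hRS, hSR,
    dotProduct_add]
  ring

lemma finner_mul_error {R S : Matrix (Fin 3) (Fin 3) ℝ} (hR : SO3 R) (hS : SO3 S)
    (A : Matrix (Fin 3) (Fin 3) ℝ) :
    finner (A * (R - S)) (R - S) = finner A ((2 : ℝ) • 1 - R * Sᵀ - (R * Sᵀ)ᵀ) := by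
  have e : (R - S) * (R - S)ᵀ = (2 : ℝ) • 1 - R * Sᵀ - (R * Sᵀ)ᵀ := by
    simp only [Matrix.transpose_sub, Matrix.transpose_mul, Matrix.transpose_transpose, sub_mul,
      mul_sub, hR.mul_transpose_self, hS.mul_transpose_self]
    module
  rw [← e, finner, finner, Matrix.transpose_mul, Matrix.mul_assoc, Matrix.trace_mul_comm,
    Matrix.mul_assoc]

lemma finner_symm_part_eq {G Q : Matrix (Fin 3) (Fin 3) ℝ} (hG : Gᵀ = G) :
    finner G ((2 : ℝ) • 1 - Q - Qᵀ) = 2 * (G.trace - (G * Q).trace) := by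
  have h : (G * Qᵀ).trace = (G * Q).trace := by
    rw [← Matrix.trace_transpose, Matrix.transpose_mul, Matrix.transpose_transpose, hG,
      Matrix.trace_mul_comm]
  simp only [finner, hG, mul_sub, Matrix.mul_smul, Matrix.mul_one, Matrix.trace_sub,
    Matrix.trace_smul, smul_eq_mul, h]
  ring

lemma finner_skew_part {G Q : Matrix (Fin 3) (Fin 3) ℝ} (hG : Gᵀ = G) (hQ : SO3 Q) :
    finner (Q - Qᵀ) (G * Qᵀ - Q * G) = -2 * (1 + Q.trace) * (G.trace - (G * Q).trace) := by
  have hT : (G * Qᵀ).trace = (G * Q).trace := by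
    rw [← Matrix.trace_transpose, Matrix.transpose_mul, Matrix.transpose_transpose, hG,
      Matrix.trace_mul_comm]
  have h1 : (Qᵀ * (G * Qᵀ)).trace = (G * (Q * Q)).trace := by
    rw [← Matrix.trace_transpose]
    simp only [Matrix.transpose_mul, Matrix.transpose_transpose, hG]
    rw [Matrix.mul_assoc, Matrix.trace_mul_comm, Matrix.mul_assoc]
  have h2 : (Q * (Q * G)).trace = (G * (Q * Q)).trace := by
    rw [← Matrix.mul_assoc, Matrix.trace_mul_comm]
  have h3 : (Q * (G * Qᵀ)).trace = G.trace := by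
    rw [Matrix.trace_mul_comm, Matrix.mul_assoc, hQ.1, Matrix.mul_one]
  have h4 : (Qᵀ * (Q * G)).trace = G.trace := by
    rw [← Matrix.mul_assoc, hQ.1, Matrix.one_mul]
  have h5 : (G * (Q * Q)).trace =
      Q.trace * (G * Q).trace - Q.trace * G.trace + (G * Q).trace := by
    rw [hQ.mul_self_eq]
    simp [mul_add, mul_sub, hT]
  simp only [finner, Matrix.transpose_sub, Matrix.transpose_transpose, sub_mul, mul_sub,
    Matrix.trace_sub, h1, h2, h3, h4, h5]
  ring

lemma finner_conj {R : Matrix (Fin 3) (Fin 3) ℝ} (hR : SO3 R) (W : Matrix (Fin 3) (Fin 3) ℝ) :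
    finner (R * W * Rᵀ) (R * W * Rᵀ) = finner W W := by
  have e : (R * W * Rᵀ)ᵀ * (R * W * Rᵀ) = R * (Wᵀ * W * Rᵀ) := by
    simp only [Matrix.transpose_mul, Matrix.transpose_transpose, Matrix.mul_assoc]
    rw [← Matrix.mul_assoc Rᵀ R, hR.1, Matrix.one_mul]
  rw [finner, finner, e, Matrix.trace_mul_comm, Matrix.mul_assoc, hR.1, Matrix.mul_one]

lemma conj_error {G R S : Matrix (Fin 3) (Fin 3) ℝ} (hR : SO3 R) :
    R * (Rᵀ * G * S - Sᵀ * G * R) * Rᵀ = G * (R * Sᵀ)ᵀ - (R * Sᵀ) * G := by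
  have h := hR.mul_transpose_self
  calc _ = (R * Rᵀ) * G * (S * Rᵀ) - R * Sᵀ * G * (R * Rᵀ) := by noncomm_ring
    _ = _ := by simp [h]

/-- If the two smallest roots of the characteristic polynomial sum to at least `c`, then
`G ≤ tr G - c` as quadratic forms. -/
lemma posSemidef_of_charpoly {G : Matrix (Fin 3) (Fin 3) ℝ} (hG : Gᵀ = G) {l1 l2 l3 c : ℝ}
    (h12 : l1 ≤ l2) (h23 : l2 ≤ l3)
    (hchar : G.charpoly = (X - C l1) * (X - C l2) * (X - C l3)) (hc : c ≤ l1 + l2) :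
    ((G.trace - c) • (1 : Matrix (Fin 3) (Fin 3) ℝ) - G).PosSemidef := by
  have htr : G.trace = l1 + l2 + l3 := by
    have h := Matrix.trace_eq_neg_charpoly_nextCoeff G
    have hn : ((X - C l1) * (X - C l2) * (X - C l3)).nextCoeff = -l1 + -l2 + -l3 := by
      rw [((monic_X_sub_C l1).mul (monic_X_sub_C l2)).nextCoeff_mul (monic_X_sub_C l3),
        (monic_X_sub_C l1).nextCoeff_mul (monic_X_sub_C l2)]
      simp only [nextCoeff_X_sub_C]
    rw [hchar, hn] at h
    linarith
  have hB : ((G.trace - c) • (1 : Matrix (Fin 3) (Fin 3) ℝ) - G).IsHermitian := by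
    rw [Matrix.IsHermitian, Matrix.conjTranspose_eq_transpose_of_trivial]
    simp [hG]
  rw [hB.posSemidef_iff_eigenvalues_nonneg]
  intro i
  have hv := hB.mulVec_eigenvectorBasis i
  have hv0 : (hB.eigenvectorBasis i).ofLp ≠ 0 := by
    intro h
    exact (hB.eigenvectorBasis.orthonormal.ne_zero i) (by ext k; exact congrFun h k)
  have hroot : (G.charpoly).eval (G.trace - c - hB.eigenvalues i) = 0 := by
    rw [Matrix.eval_charpoly, ← Matrix.exists_mulVec_eq_zero_iff]
    refine ⟨_, hv0, ?_⟩
    rw [Matrix.sub_mulVec, Matrix.smul_mulVec, Matrix.one_mulVec] at hv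
    rw [Matrix.sub_mulVec, Matrix.scalar_apply, ← Matrix.smul_one_eq_diagonal,
      Matrix.smul_mulVec, Matrix.one_mulVec, sub_smul, ← hv]
    abel
  rw [hchar] at hroot
  simp only [eval_mul, eval_sub, eval_X, eval_C, mul_eq_zero] at hroot
  show 0 ≤ hB.eigenvalues i
  rcases hroot with (h | h) | h <;> linarith

lemma mul_attitude_error_nonneg {G Q : Matrix (Fin 3) (Fin 3) ℝ} (hG : Gᵀ = G) (hQ : SO3 Q)
    {c : ℝ} (hB : ((G.trace - c) • (1 : Matrix (Fin 3) (Fin 3) ℝ) - G).PosSemidef) :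
    0 ≤ (3 - Q.trace) * (2 * (G.trace - (G * Q).trace) - c * (3 - Q.trace)) := by
  set N := Q + Qᵀ - (Q.trace - 1) • (1 : Matrix (Fin 3) (Fin 3) ℝ) with hN
  set B := (G.trace - c) • (1 : Matrix (Fin 3) (Fin 3) ℝ) - G with hBdef
  have hNt : Nᴴ = N := by
    rw [Matrix.conjTranspose_eq_transpose_of_trivial, hN]
    simp [add_comm]
  have h0 := (hB.conjTranspose_mul_mul_same N).trace_nonneg
  have hT : (G * Qᵀ).trace = (G * Q).trace := by
    rw [← Matrix.trace_transpose, Matrix.transpose_mul, Matrix.transpose_transpose, hG,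
      Matrix.trace_mul_comm]
  have hBN : (B * N).trace = 2 * (G.trace - (G * Q).trace) - c * (3 - Q.trace) := by
    simp only [hBdef, hN, sub_mul, mul_sub, mul_add, Matrix.smul_mul, Matrix.mul_smul,
      Matrix.one_mul, Matrix.mul_one, Matrix.trace_sub, Matrix.trace_add, Matrix.trace_smul,
      Matrix.trace_transpose, Matrix.trace_one, smul_eq_mul, hT, Fintype.card_fin]
    push_cast
    ring
  rw [hNt, Matrix.mul_assoc, Matrix.trace_mul_comm, Matrix.mul_assoc, hQ.axis_mul_self,
    Matrix.mul_smul, Matrix.trace_smul, hBN, smul_eq_mul] at h0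
  exact h0

lemma attitude_rate_le {G G' R S : Matrix (Fin 3) (Fin 3) ℝ} {k c d : ℝ} (hG : Gᵀ = G)
    (hR : SO3 R) (hS : SO3 S) (hc : 0 < c) (hd : 0 < d) (hk : 2 * d / c ^ 2 < k)
    (hB : ((G.trace - c) • (1 : Matrix (Fin 3) (Fin 3) ℝ) - G).PosSemidef)
    (hG' : fnorm G' ≤ d) (hV : (1 / 2) * finner (G * (R - S)) (R - S) < c) :
    (1 / 2) * finner (G' * (R - S)) (R - S) ≤
      k * (vee (Rᵀ * G * S - Sᵀ * G * R) ⬝ᵥ vee (Rᵀ * G * S - Sᵀ * G * R)) := by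
  have hQ := hR.mul_transpose hS
  rw [finner_mul_error hR hS, finner_symm_part_eq hG] at hV
  rw [finner_mul_error hR hS]
  have hcs := finner_sq_le G' ((2 : ℝ) • 1 - R * Sᵀ - (R * Sᵀ)ᵀ)
  rw [hQ.finner_symm_part, ← fnorm_sq] at hcs
  have hskew := finner_sq_le (R * Sᵀ - (R * Sᵀ)ᵀ) (G * (R * Sᵀ)ᵀ - (R * Sᵀ) * G)
  have hBt : (Rᵀ * G * S)ᵀ = Sᵀ * G * R := by
    simp [Matrix.transpose_mul, hG, Matrix.mul_assoc]
  have hW := finner_sub_transpose_self (Rᵀ * G * S)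
  rw [hBt] at hW
  rw [finner_skew_part hG hQ, hQ.finner_sub_transpose, ← conj_error hR, finner_conj hR,
    hW] at hskew
  have hpos := mul_attitude_error_nonneg hG hQ hB
  have hle := hQ.trace_le_three
  have he0 : 0 ≤ vee (Rᵀ * G * S - Sᵀ * G * R) ⬝ᵥ vee (Rᵀ * G * S - Sᵀ * G * R) :=
    Finset.sum_nonneg fun i _ => mul_self_nonneg _
  generalize vee (Rᵀ * G * S - Sᵀ * G * R) ⬝ᵥ vee (Rᵀ * G * S - Sᵀ * G * R) = e at *
  generalize finner G' ((2 : ℝ) • 1 - R * Sᵀ - (R * Sᵀ)ᵀ) = g at *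
  generalize G.trace - (G * (R * Sᵀ)).trace = V at *
  generalize (R * Sᵀ).trace = τ at *
  obtain ⟨y, rfl⟩ : ∃ y, τ = 3 - y := ⟨3 - τ, by ring⟩
  have hfn : 0 ≤ fnorm G' := Real.sqrt_nonneg _
  have hy0 : 0 ≤ y := by linarith
  have hg : 1 / 2 * g ≤ d * y := by
    have h1 : fnorm G' ^ 2 ≤ d ^ 2 := by gcongr
    have h2 : g ^ 2 ≤ (2 * d * y) ^ 2 := by
      have : fnorm G' ^ 2 * (2 * y ^ 2) ≤ d ^ 2 * (2 * y ^ 2) := by gcongr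
      have : 0 ≤ d ^ 2 * y ^ 2 := by positivity
      nlinarith
    have := abs_le_of_sq_le_sq' h2 (by positivity)
    linarith [this.2]
  have hk0 : 0 < k := lt_trans (by positivity) hk
  rcases hy0.eq_or_lt with h0 | hypos
  · rw [← h0] at hg
    nlinarith [mul_nonneg hk0.le he0]
  have hVy : c * y ≤ 2 * V := by
    have : 0 ≤ 2 * V - c * y :=
      nonneg_of_mul_nonneg_right (by simpa using hpos) hypos
    linarith
  have hy2 : y < 2 := lt_of_mul_lt_mul_left (by linarith : c * y < c * 2) hc.le
  have he : (4 - y) * V ^ 2 ≤ e * y := by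
    have h4 : 0 < 4 * (4 - y) := by linarith
    refine le_of_mul_le_mul_left ?_ h4
    nlinarith
  have hV2 : (c * y) ^ 2 ≤ (2 * V) ^ 2 := by gcongr
  have he' : c ^ 2 * y ≤ 2 * e := by
    refine le_of_mul_le_mul_right ?_ hypos
    nlinarith [mul_nonneg (by linarith : 0 ≤ 2 - y) (sq_nonneg V)]
  rw [div_lt_iff₀ (by positivity)] at hk
  have h6 : k * (c ^ 2 * y) ≤ k * (2 * e) := by gcongr
  have h7 : 2 * d * y ≤ k * c ^ 2 * y := by gcongr
  linarith

/-- A function whose derivative is nonpositive wherever the function is below `K` stays below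
`K` once it starts there, and is nonincreasing. -/
lemma sublevel_invariant {V V' : ℝ → ℝ} {K : ℝ}
    (hV : ∀ t ≥ (0 : ℝ), HasDerivAt V (V' t) t) (hV' : ∀ t ≥ (0 : ℝ), V t < K → V' t ≤ 0)
    (h0 : V 0 < K) : (∀ t ≥ (0 : ℝ), V t < K) ∧ AntitoneOn V (Set.Ici 0) := by
  have hcont : ContinuousOn V (Set.Ici 0) :=
    fun t ht => (hV t ht).continuousAt.continuousWithinAt
  have hlt : ∀ t ≥ (0 : ℝ), V t < K := by
    intro T hT
    obtain ⟨ε, hε, hεK⟩ : ∃ ε > 0, V 0 + ε * (1 + T) < K := by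
      refine ⟨(K - V 0) / (2 * (1 + T)), by have := sub_pos.mpr h0; positivity, ?_⟩
      have : (K - V 0) / (2 * (1 + T)) * (1 + T) = (K - V 0) / 2 := by
        field_simp
      linarith
    have hbound : ∀ x ∈ Set.Icc 0 T, V 0 + ε * (1 + x) < K := by
      intro x hx
      have : ε * (1 + x) ≤ ε * (1 + T) := by gcongr; exact hx.2
      linarith
    refine lt_of_le_of_lt ?_ hεK
    refine image_le_of_deriv_right_lt_deriv_boundary (f := V) (f' := V')
      (B := fun x => V 0 + ε * (1 + x)) (B' := fun _ => ε) (a := 0) (b := T)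
      (hcont.mono Set.Icc_subset_Ici_self) (fun x hx => (hV x hx.1).hasDerivWithinAt)
      (by simpa using hε.le) ?_ ?_ ⟨hT, le_rfl⟩
    · intro x
      simpa using (((hasDerivAt_id x).const_add 1).const_mul ε).const_add (V 0)
    · intro x hx hVx
      refine lt_of_le_of_lt (hV' x hx.1 ?_) hε
      rw [hVx]
      exact hbound x ⟨hx.1, hx.2.le⟩
  refine ⟨hlt, antitoneOn_of_deriv_nonpos (convex_Ici 0) hcont ?_ ?_⟩ <;>
    rw [interior_Ici] <;> intro t ht
  · exact (hV t (le_of_lt ht)).differentiableAt.differentiableWithinAt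
  · rw [(hV t (le_of_lt ht)).deriv]
    exact hV' t (le_of_lt ht) (hlt t (le_of_lt ht))

lemma hasDerivAt_vnorm_sq {k : ℕ} {x : ℝ → Fin k → ℝ} {x' : Fin k → ℝ} {t : ℝ}
    (hx : HasDerivAt x x' t) :
    HasDerivAt (fun τ => vnorm (x τ) ^ 2) (2 * (x t ⬝ᵥ x')) t := by
  simp only [vnorm_sq, dotProduct, Finset.mul_sum]
  refine HasDerivAt.fun_sum fun i _ => ?_
  have h := hasDerivAt_pi.mp hx i
  exact (h.mul h).congr_deriv (by ring)

lemma transpose_sum_smul_vecMulVec {n : ℕ} (w : Fin n → ℝ) (s : Fin n → Fin 3 → ℝ) :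
    (∑ i, w i • vecMulVec (s i) (s i))ᵀ = ∑ i, w i • vecMulVec (s i) (s i) := by
  simp [Matrix.transpose_sum, Matrix.transpose_smul, Matrix.transpose_vecMulVec]

/-- positive invariance of the sublevel set `D = {V₀ < 2ac₁}`: if
`V₀(0) < 2ac₁` then `V₀(t) < 2ac₁` for all `t ≥ 0`, and `V₀` is nonincreasing on `[0,∞)`. -/
theorem stmt_19 {n : ℕ}
    (R Rbar : ℝ → Matrix (Fin 3) (Fin 3) ℝ) (Ω : ℝ → Fin 3 → ℝ)
    (γ : Fin 3 → ℝ) (γbar : ℝ → Fin 3 → ℝ)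
    (s : Fin n → ℝ → Fin 3 → ℝ) (w : Fin n → ℝ)
    (kR kγ c₁ c₂ d a : ℝ)
    (hSO3 : ∀ t ≥ (0 : ℝ), SO3 (R t) ∧ SO3 (Rbar t))
    (hw : ∀ i, 0 < w i) (hs : ∀ i t, (s i t) ⬝ᵥ (s i t) = 1)
    (hsdiff : ∀ i t, DifferentiableAt ℝ (s i) t)
    (hkR : 0 < kR) (hkγ : 0 < kγ)
    (G : ℝ → Matrix (Fin 3) (Fin 3) ℝ)
    (hGdef : ∀ t, G t = ∑ i, w i • vecMulVec (s i t) (s i t))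
    (eR : ℝ → Fin 3 → ℝ)
    (heR : ∀ t, eR t = vee ((R t)ᵀ * G t * Rbar t - (Rbar t)ᵀ * G t * R t))
    (hRdot : ∀ t ≥ (0 : ℝ), ∀ i j, HasDerivAt (fun τ => R τ i j) ((R t * hat (Ω t)) i j) t)
    (hRbardot : ∀ t ≥ (0 : ℝ), ∀ i j, HasDerivAt (fun τ => Rbar τ i j)
      ((Rbar t * hat (Ω t + γ - γbar t - kR • eR t)) i j) t)
    (hγbardot : ∀ t ≥ (0 : ℝ), HasDerivAt γbar (kγ • eR t) t)
    (hc₁ : 0 < c₁) (hc₁₂ : c₁ ≤ c₂) (hd : 0 < d)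
    (heig : ∀ t ≥ (0 : ℝ), ∃ l1 l2 l3 : ℝ, l1 ≤ l2 ∧ l2 ≤ l3 ∧
      (G t).charpoly = (X - C l1) * (X - C l2) * (X - C l3) ∧
      c₁ ≤ l1 + l2 ∧ l2 + l3 ≤ c₂)
    (G' : ℝ → Matrix (Fin 3) (Fin 3) ℝ)
    (hG' : ∀ t ≥ (0 : ℝ), ∀ i j, HasDerivAt (fun τ => G τ i j) (G' t i j) t)
    (hGdot : ∀ t ≥ (0 : ℝ), fnorm (G' t) ≤ d)
    (ha : a ∈ Set.Ioo (0 : ℝ) (1 / 2)) (hkRd : kR > 2 * d / c₁ ^ 2)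
    (V₀ : ℝ → ℝ)
    (hV₀ : ∀ t, V₀ t = (1 / 2) * finner (G t * (R t - Rbar t)) (R t - Rbar t) +
      (1 / (2 * kγ)) * vnorm (γ - γbar t) ^ 2)
    (hIC : V₀ 0 < 2 * a * c₁) :
    (∀ t ≥ (0 : ℝ), V₀ t < 2 * a * c₁) ∧ AntitoneOn V₀ (Set.Ici 0) := by
  have hGt : ∀ t, (G t)ᵀ = G t := fun t => by
    rw [hGdef t, transpose_sum_smul_vecMulVec w fun i => s i t]
  have hderiv : ∀ t ≥ (0 : ℝ), HasDerivAt V₀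
      ((1 / 2) * finner (G' t * (R t - Rbar t)) (R t - Rbar t) - kR * (eR t ⬝ᵥ eR t)) t := by
    intro t ht
    have hE : EntryDerivAt (fun τ => R τ - Rbar τ) _ t :=
      EntryDerivAt.sub (hRdot t ht) (hRbardot t ht)
    have hGE := EntryDerivAt.mul (hG' t ht : EntryDerivAt G (G' t) t) hE
    have h1 := (hGE.transpose.mul hE).trace
    have h2 := hasDerivAt_vnorm_sq ((hγbardot t ht).const_sub γ)
    have h3 := (h1.const_mul (1 / 2)).add (h2.const_mul (1 / (2 * kγ)))
    have hx : Ω t + γ - γbar t - kR • eR t = Ω t + (γ - γbar t - kR • eR t) := by abel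
    have key := trace_error_mul_deriv (R := R t) (S := Rbar t) (hGt t) (Ω t)
      (γ - γbar t - kR • eR t)
    rw [← heR, ← hx] at key
    refine (h3.congr_of_eventuallyEq (Filter.Eventually.of_forall hV₀)).congr_deriv ?_
    set E := R t - Rbar t
    set E' := R t * hat (Ω t) - Rbar t * hat (Ω t + γ - γbar t - kR • eR t)
    have k1 : ((G t * E')ᵀ * E).trace = (Eᵀ * G t * E').trace := by
      rw [← Matrix.trace_transpose]
      simp [Matrix.transpose_mul, Matrix.mul_assoc]
    have k2 : ((G t * E)ᵀ * E').trace = (Eᵀ * G t * E').trace := by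
      rw [Matrix.transpose_mul, hGt]
    have k3 : (γ - γbar t) ⬝ᵥ -(kγ • eR t) = -(kγ * (eR t ⬝ᵥ (γ - γbar t))) := by
      rw [dotProduct_neg, dotProduct_smul, smul_eq_mul, dotProduct_comm]
    rw [dotProduct_sub, dotProduct_smul, smul_eq_mul] at key
    rw [Matrix.transpose_add, Matrix.add_mul, Matrix.trace_add, Matrix.trace_add, k1, k2, k3,
      key, finner]
    field_simp
    ring
  refine sublevel_invariant hderiv (fun t ht hVt => ?_) hIC
  obtain ⟨l1, l2, l3, h12, h23, hchar, hc, -⟩ := heig t ht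
  have hB := posSemidef_of_charpoly (hGt t) h12 h23 hchar hc
  have hV : (1 / 2) * finner (G t * (R t - Rbar t)) (R t - Rbar t) < c₁ := by
    rw [hV₀] at hVt
    have h1 : 0 ≤ (1 / (2 * kγ)) * vnorm (γ - γbar t) ^ 2 := by positivity
    have h2 : 2 * a * c₁ < c₁ := by nlinarith [ha.2]
    linarith
  have h := attitude_rate_le (hGt t) (hSO3 t ht).1 (hSO3 t ht).2 hc₁ hd hkRd hB (hGdot t ht) hV
  rw [← heR] at h
  linarith
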